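/- Let g : ℂ → ℝ be harmonic on the open unit disc 𝔻 (i.e., g is twice continuously differentiable on 𝔻 with vanishing Laplacian) and satisfy g(0) = 0. Let φ : ℂ → ℝ be a smooth function, compactly supported in 2𝔻, with φ ≡ 1 on 𝔻. For r ∈ (0, 1/2) define g_r : ℂ → ℝ by g_r(z) := φ(z/r)·g(z) for z ∈ 𝔻 and g_r(z) := 0 otherwise (so g_r is supported in the disc of radius 2r). Then the Dirichlet energy ∫_ℂ ‖∇g_r(z)‖² dA(z) tends to 0 as r → 0⁺. -/

import Mathlib

open MeasureTheory Filter Classical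

/-- Product rule bound: cutting off a function that vanishes at the origin to a disc of radius
`2 * r`, with a cutoff of slope `L / r`, keeps its derivative bounded uniformly in `r`. -/
lemma norm_fderiv_cutoff_mul_le {g φ : ℂ → ℝ} {K L : NNReal} {M δ r : ℝ} {z : ℂ}
    (hg0 : g 0 = 0) (hgd : DifferentiableAt ℝ g z)
    (hgK : LipschitzOnWith K g (Metric.ball 0 δ))
    (hφd : Differentiable ℝ φ) (hφL : LipschitzWith L φ) (hM : ∀ w, ‖φ w‖ ≤ M)
    (hr : 0 < r) (hrδ : 2 * r ≤ δ) (hz : z ∈ Metric.ball 0 (2 * r)) :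
    ‖fderiv ℝ (fun w : ℂ => φ (w / (r : ℂ)) * g w) z‖ ≤ (M + 2 * L) * K := by
  have hzr : ‖z‖ < 2 * r := by simpa using hz
  have hzδ : z ∈ Metric.ball (0 : ℂ) δ := Metric.ball_subset_ball hrδ hz
  have hφr : LipschitzWith (L * ⟨r⁻¹, by positivity⟩) (fun w : ℂ => φ (w / (r : ℂ))) := by
    refine hφL.comp (LipschitzWith.of_dist_le_mul fun x y => ?_)
    rw [dist_eq_norm, dist_eq_norm, ← sub_div, norm_div, Complex.norm_real,
      Real.norm_of_nonneg hr.le, div_eq_inv_mul]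
    rfl
  have hφr' : ‖fderiv ℝ (fun w : ℂ => φ (w / (r : ℂ))) z‖ ≤ L * r⁻¹ :=
    norm_fderiv_le_of_lipschitz ℝ hφr
  have hg' : ‖fderiv ℝ g z‖ ≤ K :=
    norm_fderiv_le_of_lipschitzOn ℝ (Metric.isOpen_ball.mem_nhds hzδ) hgK
  have hgz : ‖g z‖ ≤ K * (2 * r) := by
    have h := hgK.dist_le_mul z hzδ 0 (Metric.mem_ball_self (by linarith))
    rw [hg0, dist_zero_right, dist_zero_right] at h
    exact h.trans (by gcongr)
  have hM0 : 0 ≤ M := (norm_nonneg _).trans (hM 0)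
  have hφdr : DifferentiableAt ℝ (fun w : ℂ => φ (w / (r : ℂ))) z :=
    by
    simp only [div_eq_mul_inv]
    exact (hφd _).comp z (differentiableAt_id.mul_const _)
  rw [fderiv_fun_mul hφdr hgd]
  calc _ ≤ ‖φ (z / r)‖ * ‖fderiv ℝ g z‖ +
        ‖g z‖ * ‖fderiv ℝ (fun w : ℂ => φ (w / (r : ℂ))) z‖ := by
        refine (norm_add_le _ _).trans ?_
        rw [norm_smul, norm_smul]
    _ ≤ M * K + K * (2 * r) * (L * r⁻¹) := by
        gcongr
        exact hM _
    _ = (M + 2 * L) * K := by field_simp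

/-- **Vanishing Dirichlet energy of localized harmonic functions.**
Let `g : ℂ → ℝ` be harmonic on the unit disc (twice continuously differentiable with
vanishing Laplacian) with `g(0) = 0`, and let `φ` be a smooth bump function supported in
`2𝔻` with `φ ≡ 1` on `𝔻`. For `r > 0` let `g_r(z) = φ(z/r)·g(z)` on `𝔻` and `0` elsewhere.
Then the Dirichlet energy `∫ ‖∇ g_r‖²` tends to `0` as `r → 0⁺`. -/
theorem dirichlet_energy_localized_harmonic_tendsto_zero
    (g : ℂ → ℝ) (φ : ℂ → ℝ)
    (hg : ContDiffOn ℝ 2 g (Metric.ball (0 : ℂ) 1))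
    (harm : ∀ z ∈ Metric.ball (0 : ℂ) 1,
      iteratedFDeriv ℝ 2 g z ![1, 1] + iteratedFDeriv ℝ 2 g z ![Complex.I, Complex.I] = 0)
    (hg0 : g 0 = 0)
    (hφ : ContDiff ℝ (⊤ : ℕ∞) φ)
    (hφsupp : tsupport φ ⊆ Metric.ball (0 : ℂ) 2)
    (hφ1 : ∀ z ∈ Metric.ball (0 : ℂ) 1, φ z = 1) :
    Tendsto
      (fun r : ℝ => ∫ z : ℂ,
        ‖fderiv ℝ (fun w : ℂ =>
            if w ∈ Metric.ball (0 : ℂ) 1 then φ (w / (r : ℂ)) * g w else 0) z‖ ^ 2)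
      (nhdsWithin 0 (Set.Ioo 0 (1 / 2))) (nhds 0) := by
  have hφc : HasCompactSupport φ :=
    (isCompact_closedBall (0 : ℂ) 2).of_isClosed_subset (isClosed_tsupport φ)
      (hφsupp.trans Metric.ball_subset_closedBall)
  obtain ⟨M, hM⟩ := hφc.exists_bound_of_continuous hφ.continuous
  obtain ⟨L, hL⟩ := (hφ.lipschitzWith_of_hasCompactSupport hφc (by simp))
  have hg1 : ContDiffAt ℝ 1 g 0 :=
    (hg.contDiffAt (Metric.ball_mem_nhds 0 one_pos)).of_le (by norm_num)
  obtain ⟨K, t, ht, hK⟩ := hg1.exists_lipschitzOnWith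
  obtain ⟨δ, hδ, hδt⟩ := Metric.mem_nhds_iff.mp ht
  set C : ℝ := ((M + 2 * L) * K) ^ 2
  have hlim : Tendsto (fun r : ℝ => C * volume.real (Metric.ball (0 : ℂ) (2 * r)))
      (nhdsWithin 0 (Set.Ioo 0 (1 / 2))) (nhds 0) := by
    have hcont : Tendsto (fun r : ℝ => C * ((2 * r) ^ 2 * Real.pi))
        (nhdsWithin 0 (Set.Ioo 0 (1 / 2))) (nhds 0) :=
      ((by fun_prop : Continuous fun r : ℝ => C * ((2 * r) ^ 2 * Real.pi)).tendsto' 0 0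
        (by simp)).mono_left nhdsWithin_le_nhds
    refine hcont.congr' ?_
    filter_upwards [self_mem_nhdsWithin] with r hr
    have hr0 : 0 ≤ r := hr.1.le
    simp [Measure.real, Complex.volume_ball, ENNReal.toReal_ofReal hr0]
  refine squeeze_zero_norm' ?_ hlim
  have hsmall : ∀ᶠ r : ℝ in nhdsWithin 0 (Set.Ioo 0 (1 / 2)), r < δ / 2 :=
    nhdsWithin_le_nhds (Iio_mem_nhds (by positivity))
  filter_upwards [self_mem_nhdsWithin, hsmall] with r hr hrδ
  have hr0 : 0 < r := hr.1
  rw [← setIntegral_eq_integral_of_forall_compl_eq_zero (s := Metric.ball (0 : ℂ) (2 * r))]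
  · refine norm_setIntegral_le_of_norm_le_const measure_ball_lt_top fun z hz => ?_
    have hz1 : Metric.ball (0 : ℂ) 1 ∈ nhds z :=
      Metric.isOpen_ball.mem_nhds (Metric.ball_subset_ball (by linarith [hr.2]) hz)
    have heq : (fun w : ℂ => if w ∈ Metric.ball (0 : ℂ) 1 then φ (w / (r : ℂ)) * g w else 0)
        =ᶠ[nhds z] fun w => φ (w / (r : ℂ)) * g w := by
      filter_upwards [hz1] with w hw using if_pos hw
    rw [heq.fderiv_eq, norm_pow, norm_norm]
    refine pow_le_pow_left₀ (norm_nonneg _) ?_ 2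
    exact norm_fderiv_cutoff_mul_le hg0 ((hg.contDiffAt hz1).differentiableAt (by norm_num))
      (hK.mono hδt) (hφ.differentiable (by simp)) hL hM hr0 (by linarith) hz
  · intro z hz
    have hzr : 2 * r ≤ ‖z‖ := by simpa using hz
    have hzφ : z / (r : ℂ) ∉ tsupport φ := fun h => by
      have h2 : ‖z / (r : ℂ)‖ < 2 := by simpa using hφsupp h
      rw [norm_div, Complex.norm_real, Real.norm_of_nonneg hr0.le, div_lt_iff₀ hr0] at h2
      linarith
    have hφ0 : ∀ᶠ w in nhds z, φ (w / (r : ℂ)) = 0 :=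
      (continuous_id.div_const (r : ℂ)).continuousAt.eventually
        (notMem_tsupport_iff_eventuallyEq.mp hzφ)
    have heq : (fun w : ℂ => if w ∈ Metric.ball (0 : ℂ) 1 then φ (w / (r : ℂ)) * g w else 0)
        =ᶠ[nhds z] fun _ => 0 := by
      filter_upwards [hφ0] with w hw
      simp [hw]
    rw [heq.fderiv_eq]
    simp
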